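/- There is a continuum of pairwise nonisomorphic finitely generated groups which are locally stable but not weakly stable: there exists a family (G_i)_{i ∈ I} of groups indexed by a set I of cardinality 2^{ℵ₀} such that each G_i is finitely generated, locally stable, and not weakly stable, and G_i is not isomorphic to G_j whenever i ≠ j. -/

import Mathlib

open Filter Topology

open scoped Classical

/-- Normalized Hamming metric on `Sym(k)`:
`d_k(σ,τ) = |{i : σ i ≠ τ i}| / k` (which equals `1 - |{i : σ i = τ i}|/k` for `k ≥ 1`). -/
noncomputable def dHam {k : ℕ} (σ τ : Equiv.Perm (Fin k)) : ℝ :=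
  ((Finset.univ.filter fun i => σ i ≠ τ i).card : ℝ) / k

/-- `(φ_n)` is an almost-homomorphism. -/
def IsAlmostHom {Γ : Type*} [Group Γ] (k : ℕ → ℕ)
    (φ : ∀ n, Γ → Equiv.Perm (Fin (k n))) : Prop :=
  ∀ g h : Γ,
    Tendsto (fun n => dHam (φ n g * φ n h) (φ n (g * h))) atTop (𝓝 0)

/-- `(φ_n)` is a partial homomorphism. -/
def IsPartialHom {Γ : Type*} [Group Γ] (k : ℕ → ℕ)
    (φ : ∀ n, Γ → Equiv.Perm (Fin (k n))) : Prop :=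
  ∀ g h : Γ, ∀ᶠ n in atTop, φ n (g * h) = φ n g * φ n h

/-- `(φ_n)` is separating. -/
def IsSeparating {Γ : Type*} [Group Γ] (k : ℕ → ℕ)
    (φ : ∀ n, Γ → Equiv.Perm (Fin (k n))) : Prop :=
  ∀ g : Γ, g ≠ 1 → Tendsto (fun n => dHam (φ n g) 1) atTop (𝓝 1)

/-- `(φ_n)` is a sequence of genuine homomorphisms. -/
def IsHomSeq {Γ : Type*} [Group Γ] (k : ℕ → ℕ)
    (φ : ∀ n, Γ → Equiv.Perm (Fin (k n))) : Prop :=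
  ∀ n, ∀ g h : Γ, φ n (g * h) = φ n g * φ n h

/-- `(ψ_n)` is asymptotically close to `(φ_n)`: for every `g`, `d_{k_n}(φ_n g, ψ_n g) → 0`. -/
def CloseSeq {Γ : Type*} [Group Γ] (k : ℕ → ℕ)
    (φ ψ : ∀ n, Γ → Equiv.Perm (Fin (k n))) : Prop :=
  ∀ g : Γ, Tendsto (fun n => dHam (φ n g) (ψ n g)) atTop (𝓝 0)

/-- `Γ` is locally stable. -/
def IsLocallyStable (Γ : Type*) [Group Γ] : Prop :=
  ∀ (k : ℕ → ℕ), (∀ n, 0 < k n) →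
    ∀ φ : ∀ n, Γ → Equiv.Perm (Fin (k n)), IsAlmostHom k φ →
      ∃ ψ : ∀ n, Γ → Equiv.Perm (Fin (k n)), IsPartialHom k ψ ∧ CloseSeq k φ ψ

/-- `Γ` is weakly locally stable. -/
def IsWeaklyLocallyStable (Γ : Type*) [Group Γ] : Prop :=
  ∀ (k : ℕ → ℕ), (∀ n, 0 < k n) →
    ∀ φ : ∀ n, Γ → Equiv.Perm (Fin (k n)), IsAlmostHom k φ → IsSeparating k φ →
      ∃ ψ : ∀ n, Γ → Equiv.Perm (Fin (k n)), IsPartialHom k ψ ∧ CloseSeq k φ ψ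

/-- `Γ` is stable (in permutations). -/
def IsStable (Γ : Type*) [Group Γ] : Prop :=
  ∀ (k : ℕ → ℕ), (∀ n, 0 < k n) →
    ∀ φ : ∀ n, Γ → Equiv.Perm (Fin (k n)), IsAlmostHom k φ →
      ∃ ψ : ∀ n, Γ → Equiv.Perm (Fin (k n)), IsHomSeq k ψ ∧ CloseSeq k φ ψ

/-- `Γ` is weakly stable. -/
def IsWeaklyStable (Γ : Type*) [Group Γ] : Prop :=
  ∀ (k : ℕ → ℕ), (∀ n, 0 < k n) →
    ∀ φ : ∀ n, Γ → Equiv.Perm (Fin (k n)), IsAlmostHom k φ → IsSeparating k φ →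
      ∃ ψ : ∀ n, Γ → Equiv.Perm (Fin (k n)), IsHomSeq k ψ ∧ CloseSeq k φ ψ

/-- `Γ` is sofic: it admits a separating almost-homomorphism. -/
def IsSofic (Γ : Type*) [Group Γ] : Prop :=
  ∃ (k : ℕ → ℕ), (∀ n, 0 < k n) ∧
    ∃ φ : ∀ n, Γ → Equiv.Perm (Fin (k n)), IsAlmostHom k φ ∧ IsSeparating k φ

/-- `Γ` is LEF: it admits a separating partial homomorphism. -/
def IsLEF (Γ : Type*) [Group Γ] : Prop :=
  ∃ (k : ℕ → ℕ), (∀ n, 0 < k n) ∧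
    ∃ φ : ∀ n, Γ → Equiv.Perm (Fin (k n)), IsPartialHom k φ ∧ IsSeparating k φ


section ZeroSum

/-- A finite family of integer vectors with entries bounded by `B` contains a zero-sum subfamily
whose complement has size at most a constant times the size of the total sum. -/
theorem exists_zeroSum_subfamily (κ : Type) [Fintype κ] (B : ℕ) :
    ∃ C : ℕ, ∀ (Ω : Type) [Fintype Ω] [DecidableEq Ω] (w : Ω → κ → ℤ), (∀ ω k, |w ω k| ≤ B) →
      ∃ S : Finset Ω, (∀ k, ∑ ω ∈ S, w ω k = 0) ∧
        ((Sᶜ.card : ℕ) : ℤ) ≤ C * ∑ k, |∑ ω, w ω k| := by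
  let W := κ → Finset.Icc (-(B : ℤ)) B
  let M := (W → ℕ) × (κ → ℕ) × (κ → ℕ)
  let f : M →+ (κ → ℤ) :=
    { toFun := fun m k => ∑ v : W, (m.1 v : ℤ) * (v k : ℤ) + (m.2.1 k : ℤ)
      map_zero' := by ext k; simp
      map_add' := by
        rintro ⟨x, p, q⟩ ⟨x', p', q'⟩; ext k
        change ∑ v : W, ((x v + x' v : ℕ) : ℤ) * (v k : ℤ) + ((p k + p' k : ℕ) : ℤ) =
          (∑ v : W, (x v : ℤ) * (v k : ℤ) + p k) + (∑ v : W, (x' v : ℤ) * (v k : ℤ) + p' k)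
        push_cast
        simp only [add_mul, Finset.sum_add_distrib]; ring }
  let g : M →+ (κ → ℤ) :=
    { toFun := fun m k => (m.2.2 k : ℤ)
      map_zero' := by ext k; simp
      map_add' := by
        rintro ⟨x, p, q⟩ ⟨x', p', q'⟩; ext k
        exact Nat.cast_add (q k) (q' k) }
  obtain ⟨gens, hgens⟩ := AddSubmonoid.fg_eqLocusM f g
  let C : ℕ := gens.sup (fun m => ∑ v, m.1 v)
  have key : ∀ m ∈ f.eqLocusM g, ∃ y : W → ℕ, (∀ v, y v ≤ m.1 v) ∧
      (∀ k, ∑ v : W, (y v : ℤ) * (v k : ℤ) = 0) ∧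
      ∑ v, m.1 v ≤ ∑ v, y v + C * (∑ k, m.2.1 k + ∑ k, m.2.2 k) := by
    intro m hm
    rw [← hgens] at hm
    induction hm using AddSubmonoid.closure_induction with
    | mem m hm =>
      have hmem : m ∈ f.eqLocusM g := by
        rw [← hgens]; exact AddSubmonoid.subset_closure hm
      have hfg : ∀ k, ∑ v : W, (m.1 v : ℤ) * (v k : ℤ) + (m.2.1 k : ℤ) = (m.2.2 k : ℤ) :=
        fun k => congrFun (show f m = g m from hmem) k
      by_cases h0 : ∑ k, m.2.1 k + ∑ k, m.2.2 k = 0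
      · refine ⟨m.1, fun v => le_rfl, fun k => ?_, by simp⟩
        have h1 : m.2.1 k = 0 := by
          have := Finset.single_le_sum (f := m.2.1) (fun i _ => Nat.zero_le _) (Finset.mem_univ k)
          omega
        have h2 : m.2.2 k = 0 := by
          have := Finset.single_le_sum (f := m.2.2) (fun i _ => Nat.zero_le _) (Finset.mem_univ k)
          omega
        have := hfg k
        rw [h1, h2] at this
        simpa using this
      · refine ⟨0, fun v => Nat.zero_le _, fun k => by simp, ?_⟩
        have h1 : ∑ v, m.1 v ≤ C := Finset.le_sup (f := fun m : M => ∑ v, m.1 v) hm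
        have h2 : C * 1 ≤ C * (∑ k, m.2.1 k + ∑ k, m.2.2 k) :=
          Nat.mul_le_mul_left _ (Nat.one_le_iff_ne_zero.mpr h0)
        simp only [Pi.zero_apply, Finset.sum_const_zero]
        omega
    | zero => exact ⟨0, fun v => le_rfl, fun k => by simp, by simp⟩
    | add a b _ _ iha ihb =>
      obtain ⟨y, hy1, hy2, hy3⟩ := iha
      obtain ⟨z, hz1, hz2, hz3⟩ := ihb
      refine ⟨y + z, fun v => add_le_add (hy1 v) (hz1 v), fun k => ?_, ?_⟩
      · simp [add_mul, Finset.sum_add_distrib, hy2 k, hz2 k]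
      · change ∑ v, (a.1 v + b.1 v) ≤ ∑ v, (y v + z v) +
          C * (∑ k, (a.2.1 k + b.2.1 k) + ∑ k, (a.2.2 k + b.2.2 k))
        simp only [Finset.sum_add_distrib]
        linarith
  refine ⟨C, fun Ω _ _ w hw => ?_⟩
  let r : Ω → W := fun ω k => ⟨w ω k, Finset.mem_Icc.mpr (abs_le.mp (hw ω k))⟩
  let fib : W → Finset Ω := fun v => Finset.univ.filter fun ω => r ω = v
  let x : W → ℕ := fun v => (fib v).card
  have hsum : ∀ k, ∑ v : W, (x v : ℤ) * (v k : ℤ) = ∑ ω, w ω k := by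
    intro k
    rw [← Finset.sum_fiberwise (s := Finset.univ) (g := r)]
    refine Finset.sum_congr rfl fun v _ => ?_
    rw [Finset.sum_congr rfl (g := fun _ => (v k : ℤ)), Finset.sum_const, nsmul_eq_mul]
    intro ω hω
    rw [← (Finset.mem_filter.mp hω).2]
  let m : M := (x, fun k => (-∑ ω, w ω k).toNat, fun k => (∑ ω, w ω k).toNat)
  have hm : m ∈ f.eqLocusM g := by
    change f m = g m
    funext k
    change ∑ v : W, (x v : ℤ) * (v k : ℤ) + ((-∑ ω, w ω k).toNat : ℤ) = ((∑ ω, w ω k).toNat : ℤ)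
    rw [hsum]; omega
  obtain ⟨y, hy1, hy2, hy3⟩ := key m hm
  choose s hs1 hs2 using fun v => Finset.exists_subset_card_eq (hy1 v)
  have hr : ∀ v, ∀ ω ∈ s v, r ω = v := fun v ω h => (Finset.mem_filter.mp (hs1 v h)).2
  have hdisj : ((Finset.univ : Finset W) : Set W).PairwiseDisjoint s := by
    intro v _ v' _ hvv'
    refine Finset.disjoint_left.mpr fun ω h h' => hvv' ?_
    rw [← hr v ω h, hr v' ω h']
  refine ⟨Finset.univ.biUnion s, fun k => ?_, ?_⟩
  · rw [Finset.sum_biUnion hdisj, ← hy2 k]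
    refine Finset.sum_congr rfl fun v _ => ?_
    rw [← hs2 v, Finset.sum_congr rfl (g := fun _ => (v k : ℤ)), Finset.sum_const, nsmul_eq_mul]
    intro ω hω
    rw [← hr v ω hω]
  · have h1 : (Finset.univ.biUnion s).card = ∑ v, y v := by
      rw [Finset.card_biUnion hdisj]
      exact Finset.sum_congr rfl fun v _ => hs2 v
    have h2 : Fintype.card Ω = ∑ v, x v := by
      rw [← Finset.card_univ]
      exact Finset.card_eq_sum_card_fiberwise (fun _ _ => Finset.mem_univ _)
    have h3 := Finset.card_compl_add_card (Finset.univ.biUnion s)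
    have h4 : ((∑ k, m.2.1 k + ∑ k, m.2.2 k : ℕ) : ℤ) = ∑ k, |∑ ω, w ω k| := by
      rw [← Finset.sum_add_distrib]
      push_cast
      refine Finset.sum_congr rfl fun k _ => ?_
      change ((-∑ ω, w ω k).toNat : ℤ) + ((∑ ω, w ω k).toNat : ℤ) = _
      rw [abs_eq_max_neg]; omega
    rw [← h4]
    have h5 : ∑ v, x v ≤ ∑ v, y v + C * (∑ k, m.2.1 k + ∑ k, m.2.2 k) := hy3
    have h6 : (Finset.univ.biUnion s)ᶜ.card ≤ C * (∑ k, m.2.1 k + ∑ k, m.2.2 k) := by omega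
    exact_mod_cast h6

end ZeroSum

section PermutationActions

variable {A X : Type} [Group A]

/-- A family of permutations that restricts to an action on `Y` agrees on `Y` with an action that
is trivial off `Y`. -/
theorem exists_hom_eq_on (Y : Set X) (φ : A → Equiv.Perm X)
    (hY : ∀ g, ∀ x ∈ Y, φ g x ∈ Y) (h1 : ∀ x ∈ Y, φ 1 x = x)
    (hmul : ∀ g h, ∀ x ∈ Y, φ (g * h) x = φ g (φ h x)) :
    ∃ ρ : A →* Equiv.Perm X, (∀ g, ∀ x ∈ Y, ρ g x = φ g x) ∧ ∀ g, ∀ x ∉ Y, ρ g x = x := by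
  let r : A →* Function.End X :=
    { toFun := fun g x => if x ∈ Y then φ g x else x
      map_one' := by
        funext x
        by_cases hx : x ∈ Y
        · simp only [hx, if_true]; exact h1 x hx
        · simp only [hx, if_false]; rfl
      map_mul' := by
        intro g h; funext x
        change (if x ∈ Y then φ (g * h) x else x) =
          if (if x ∈ Y then φ h x else x) ∈ Y then φ g (if x ∈ Y then φ h x else x)
          else if x ∈ Y then φ h x else x
        by_cases hx : x ∈ Y
        · simp [hx, hY h x hx, hmul g h x hx]
        · simp [hx] }
  have hr : ∀ g x, r.toHomPerm g x = if x ∈ Y then φ g x else x := fun _ _ => rfl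
  refine ⟨r.toHomPerm, fun g x hx => ?_, fun g x hx => ?_⟩
  · rw [hr, if_pos hx]
  · rw [hr, if_neg hx]

/-- The stabilizer of `x` under the action `α`. -/
def fixers (α : A →* Equiv.Perm X) (x : X) : Subgroup A :=
  (MulAction.stabilizer (Equiv.Perm X) x).comap α

theorem mem_fixers {α : A →* Equiv.Perm X} {x : X} {a : A} : a ∈ fixers α x ↔ α a x = x :=
  Iff.rfl

/-- The number of points of `U` whose stabilizer under `α` is `K`. -/
noncomputable def typeCount (α : A →* Equiv.Perm X) (U : Set X) (K : Subgroup A) : ℕ :=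
  {x ∈ U | fixers α x = K}.ncard

theorem fixers_of_equivariant {α β : A →* Equiv.Perm X} {U : Set X} {e : X → X}
    (hU : ∀ a, ∀ x ∈ U, α a x ∈ U) (hinj : Set.InjOn e U)
    (he : ∀ a, ∀ x ∈ U, e (α a x) = β a (e x)) {x : X} (hx : x ∈ U) :
    fixers β (e x) = fixers α x := by
  ext a
  rw [mem_fixers, mem_fixers, ← he a x hx]
  exact ⟨fun h => hinj (hU a x hx) hx h, fun h => by rw [h]⟩

theorem typeCount_image {α β : A →* Equiv.Perm X} {U : Set X} {e : X → X}
    (hU : ∀ a, ∀ x ∈ U, α a x ∈ U) (hinj : Set.InjOn e U)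
    (he : ∀ a, ∀ x ∈ U, e (α a x) = β a (e x)) (K : Subgroup A) :
    typeCount β (e '' U) K = typeCount α U K := by
  have h : {y ∈ e '' U | fixers β y = K} = e '' {x ∈ U | fixers α x = K} := by
    ext y
    constructor
    · rintro ⟨⟨x, hx, rfl⟩, hK⟩
      exact ⟨x, ⟨hx, by rw [← fixers_of_equivariant hU hinj he hx, hK]⟩, rfl⟩
    · rintro ⟨x, ⟨hx, hK⟩, rfl⟩
      exact ⟨⟨x, hx, rfl⟩, by rw [fixers_of_equivariant hU hinj he hx, hK]⟩
  rw [typeCount, h, Set.InjOn.ncard_image (hinj.mono fun x hx => hx.1), typeCount]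

theorem typeCount_union [Finite X] (α : A →* Equiv.Perm X) {U V : Set X} (h : Disjoint U V)
    (K : Subgroup A) : typeCount α (U ∪ V) K = typeCount α U K + typeCount α V K := by
  rw [typeCount, typeCount, typeCount, ← Set.ncard_union_eq _ (Set.toFinite _) (Set.toFinite _)]
  · congr 1
    ext x
    simp [or_and_right]
  · exact h.mono (fun x hx => hx.1) (fun x hx => hx.1)

theorem typeCount_sdiff [Finite X] (α : A →* Equiv.Perm X) {U V : Set X} (h : U ⊆ V)
    (K : Subgroup A) : typeCount α V K = typeCount α U K + typeCount α (V \ U) K := by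
  rw [← typeCount_union α Set.disjoint_sdiff_right, Set.union_sdiff_cancel h]

theorem typeCount_le [Finite X] (α : A →* Equiv.Perm X) (U : Set X) (K : Subgroup A) :
    typeCount α U K ≤ U.ncard :=
  Set.ncard_le_ncard (fun _ hx => hx.1) (Set.toFinite _)

theorem typeCount_preimage [Finite X] {Ω : Type} (α : A →* Equiv.Perm X) (π : X → Ω)
    (S : Finset Ω) (K : Subgroup A) :
    typeCount α (π ⁻¹' S) K = ∑ ω ∈ S, typeCount α (π ⁻¹' {ω}) K := by
  induction S using Finset.induction_on with
  | empty => simp [typeCount]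
  | insert ω S hω ih =>
    rw [Finset.sum_insert hω, ← ih, ← typeCount_union]
    · congr 1
      ext x
      simp
    · rw [Set.disjoint_left]
      rintro x hx hx'
      apply hω
      rw [← show π x = ω from hx]
      exact hx'

/-- If two finite invariant sets have the same number of points with each stabilizer, then every
injective equivariant map from an invariant subset of one to the other extends to an equivariant
bijection. -/
theorem exists_equivariant_bijOn [Finite X] (α β : A →* Equiv.Perm X) {U V : Set X}
    (hU : ∀ a, ∀ x ∈ U, α a x ∈ U) (hV : ∀ a, ∀ x ∈ V, β a x ∈ V)
    (hcount : ∀ K, typeCount α U K = typeCount β V K) (U₀ : Set X) (hsub : U₀ ⊆ U)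
    (hU₀ : ∀ a, ∀ x ∈ U₀, α a x ∈ U₀) (e₀ : X → X) (hmaps : Set.MapsTo e₀ U₀ V)
    (hinj : Set.InjOn e₀ U₀) (he₀ : ∀ a, ∀ x ∈ U₀, e₀ (α a x) = β a (e₀ x)) :
    ∃ e : X → X, Set.EqOn e e₀ U₀ ∧ Set.BijOn e U V ∧
      ∀ a, ∀ x ∈ U, e (α a x) = β a (e x) := by
  induction hn : (U \ U₀).ncard using Nat.strong_induction_on generalizing U₀ e₀ with
  | _ n ih =>
  have hrest : ∀ K, typeCount α (U \ U₀) K = typeCount β (V \ e₀ '' U₀) K := by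
    intro K
    have h1 := typeCount_sdiff α hsub K
    have h2 := typeCount_sdiff β hmaps.image_subset K
    rw [typeCount_image hU₀ hinj he₀, ← hcount K] at h2
    omega
  by_cases hUU : U ⊆ U₀
  · have hEq : U₀ = U := hsub.antisymm hUU
    subst hEq
    refine ⟨e₀, fun _ _ => rfl, ⟨hmaps, hinj, fun v hv => ?_⟩, he₀⟩
    by_contra hv'
    have h := hrest (fixers β v)
    rw [sdiff_self] at h
    have : 0 < typeCount β (V \ e₀ '' U₀) (fixers β v) :=
      (Set.ncard_pos (Set.toFinite _)).mpr ⟨v, ⟨hv, hv'⟩, rfl⟩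
    rw [← h] at this
    simp [typeCount] at this
  · obtain ⟨u, huU, hu0⟩ := Set.not_subset.mp hUU
    have hpos : 0 < typeCount α (U \ U₀) (fixers α u) :=
      (Set.ncard_pos (Set.toFinite _)).mpr ⟨u, ⟨huU, hu0⟩, rfl⟩
    rw [hrest] at hpos
    obtain ⟨v, ⟨hvV, hv0⟩, hfix⟩ := (Set.ncard_pos (Set.toFinite _)).mp hpos
    have hfix' : ∀ a b, α a u = α b u ↔ β a v = β b v := by
      intro a b
      have h : b⁻¹ * a ∈ fixers β v ↔ b⁻¹ * a ∈ fixers α u := by rw [hfix]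
      rw [mem_fixers, mem_fixers, map_mul, map_mul, map_inv, map_inv, Equiv.Perm.mul_apply,
        Equiv.Perm.mul_apply, Equiv.Perm.inv_eq_iff_eq, Equiv.Perm.inv_eq_iff_eq] at h
      exact h.symm
    have hnot : ∀ a, α a u ∉ U₀ := fun a ha => hu0 (by simpa using hU₀ a⁻¹ _ ha)
    have hnot' : ∀ a, β a v ∉ e₀ '' U₀ := by
      rintro a ⟨x, hx, hxa⟩
      exact hv0 ⟨α a⁻¹ x, hU₀ _ _ hx, by rw [he₀ _ _ hx, hxa]; simp⟩
    let e₁ : X → X := fun x => if h : ∃ a, α a u = x then β h.choose v else e₀ x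
    have he₁u : ∀ a, e₁ (α a u) = β a v := by
      intro a
      have h : ∃ b, α b u = α a u := ⟨a, rfl⟩
      simp only [e₁, dif_pos h]
      exact (hfix' _ _).mp h.choose_spec
    have he₁0 : ∀ x ∈ U₀, e₁ x = e₀ x := by
      intro x hx
      have h : ¬ ∃ a, α a u = x := by
        rintro ⟨a, rfl⟩
        exact hnot a hx
      simp only [e₁, dif_neg h]
    let U₁ : Set X := U₀ ∪ Set.range fun a => α a u
    have hu1 : u ∈ U₁ := Or.inr ⟨1, by simp⟩
    have hsub1 : U₁ ⊆ U := by
      rintro x (hx | ⟨a, rfl⟩)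
      exacts [hsub hx, hU a u huU]
    have hlt : (U \ U₁).ncard < n := by
      rw [← hn]
      refine Set.ncard_lt_ncard ⟨fun x hx => ⟨hx.1, fun h => hx.2 (Or.inl h)⟩, fun h => ?_⟩
        (Set.toFinite _)
      exact (h ⟨huU, hu0⟩).2 hu1
    obtain ⟨e, h1, h2, h3⟩ := ih _ hlt U₁ hsub1
      (by
        rintro a x (hx | ⟨b, rfl⟩)
        · exact Or.inl (hU₀ a x hx)
        · exact Or.inr ⟨a * b, by simp⟩) e₁
      (by
        rintro x (hx | ⟨a, rfl⟩)
        · rw [he₁0 x hx]; exact hmaps hx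
        · simp only [he₁u]; exact hV a v hvV)
      (by
        rintro x (hx | ⟨a, rfl⟩) y (hy | ⟨b, rfl⟩) hxy
        · rw [he₁0 x hx, he₁0 y hy] at hxy; exact hinj hx hy hxy
        · simp only [he₁u, he₁0 x hx] at hxy; exact absurd ⟨x, hx, hxy⟩ (hnot' b)
        · simp only [he₁u, he₁0 y hy] at hxy; exact absurd ⟨y, hy, hxy.symm⟩ (hnot' a)
        · simp only [he₁u] at hxy; exact (hfix' a b).mpr hxy)
      (by
        rintro a x (hx | ⟨b, rfl⟩)
        · rw [he₁0 x hx, he₁0 _ (hU₀ a x hx), he₀ a x hx]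
        · have := he₁u (a * b)
          simp only [map_mul, Equiv.Perm.mul_apply] at this
          simp only [he₁u, this]) rfl
    exact ⟨e, fun x hx => (h1 (Or.inl hx)).trans (he₁0 x hx), h2, h3⟩

/-- An action of `F` together with a permutation `T` that almost intertwines the two restrictions
to `A` along `i` and `j` is close to a pair for which `T` intertwines exactly. -/
theorem exists_exact_intertwiner (A F : Type) [Group A] [Group F] [Finite A] [Finite F]
    (i j : A →* F) : ∃ C : ℕ, ∀ (X : Type) [Finite X] (ρ : F →* Equiv.Perm X) (T : Equiv.Perm X),
      ∃ (ρ' : F →* Equiv.Perm X) (T' : Equiv.Perm X) (Z : Set X),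
        (∀ a x, T' (ρ' (i a) x) = ρ' (j a) (T' x)) ∧
        Z.ncard ≤ C * {x | ∃ a, T (ρ (i a) x) ≠ ρ (j a) (T x)}.ncard ∧
        ∀ x ∉ Z, T' x = T x ∧ ∀ g, ρ' g x = ρ g x := by
  have : Fintype (Subgroup A) := Fintype.ofFinite _
  obtain ⟨C, hC⟩ := exists_zeroSum_subfamily (Subgroup A) (Nat.card F)
  refine ⟨2 * (Nat.card F * (C * Fintype.card (Subgroup A))) + 1, fun X _ ρ T => ?_⟩
  have : Fintype X := Fintype.ofFinite X
  set E : Set X := {x | ∃ a, T (ρ (i a) x) ≠ ρ (j a) (T x)} with hE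
  have hEc : ∀ x ∉ E, ∀ a, T (ρ (i a) x) = ρ (j a) (T x) := by
    intro x hx a
    by_contra h
    exact hx ⟨a, h⟩
  have hEinv : ∀ b, ∀ x ∉ E, ρ (i b) x ∉ E := by
    rintro b x hx ⟨a, ha⟩
    apply ha
    have h := hEc x hx (a * b)
    simp only [map_mul, Equiv.Perm.mul_apply] at h
    rw [h, hEc x hx b]
  let α : A →* Equiv.Perm X := ρ.comp i
  let β : A →* Equiv.Perm X := ρ.comp j
  let s : Setoid X :=
    { r := fun x y => ∃ g, ρ g x = y
      iseqv := ⟨fun x => ⟨1, by simp⟩, fun ⟨g, hg⟩ => ⟨g⁻¹, by simp [← hg]⟩,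
        fun ⟨g, hg⟩ ⟨h, hh⟩ => ⟨h * g, by simp [hg, hh]⟩⟩ }
  let π : X → Quotient s := Quotient.mk s
  have : Fintype (Quotient s) := Fintype.ofFinite _
  have hπ : ∀ g x, π (ρ g x) = π x := fun g x => (Quotient.sound ⟨g, rfl⟩ : π x = _).symm
  have hfib : ∀ ω, (π ⁻¹' {ω}).ncard ≤ Nat.card F := by
    intro ω
    obtain ⟨x, rfl⟩ := Quotient.exists_rep ω
    have h : π ⁻¹' {Quotient.mk s x} ⊆ (fun g => ρ g x) '' Set.univ := by
      intro y hy
      obtain ⟨g, hg⟩ := Quotient.exact (show π x = π y from (show π y = π x from hy).symm)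
      exact ⟨g, trivial, hg⟩
    calc _ ≤ _ := Set.ncard_le_ncard h (Set.toFinite _)
      _ ≤ (Set.univ : Set F).ncard := Set.ncard_image_le (Set.toFinite _)
      _ = Nat.card F := Set.ncard_univ F
  let w : Quotient s → Subgroup A → ℤ := fun ω K =>
    (typeCount α (π ⁻¹' {ω}) K : ℤ) - typeCount β (π ⁻¹' {ω}) K
  obtain ⟨S, hS0, hSc⟩ := hC (Quotient s) w (by
    intro ω K
    have h1 := (typeCount_le α (π ⁻¹' {ω}) K).trans (hfib ω)
    have h2 := (typeCount_le β (π ⁻¹' {ω}) K).trans (hfib ω)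
    simp only [w]
    rw [abs_le]; omega)
  have hw : ∀ (R : Finset (Quotient s)) K, ∑ ω ∈ R, w ω K =
      (typeCount α (π ⁻¹' R) K : ℤ) - typeCount β (π ⁻¹' R) K := by
    intro R K
    rw [typeCount_preimage, typeCount_preimage, Finset.sum_sub_distrib]
    push_cast; rfl
  have htot : ∀ K, |∑ ω, w ω K| ≤ (E.ncard : ℤ) := by
    intro K
    rw [hw]
    simp only [Finset.coe_univ, Set.preimage_univ]
    have h1 := typeCount_sdiff α (Set.subset_univ E) K
    have h2 := typeCount_sdiff β (Set.subset_univ (T '' E)) K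
    rw [← Set.compl_eq_univ_sdiff] at h1 h2
    rw [← Set.image_compl_eq T.bijective, typeCount_image (α := α) (β := β) (U := Eᶜ) (fun a x hx => hEinv a x hx)
      T.injective.injOn (fun a x hx => hEc x hx a)] at h2
    have h3 := typeCount_le α E K
    have h4 := typeCount_le β (T '' E) K
    rw [Set.ncard_image_of_injective _ T.injective] at h4
    rw [abs_le]; omega
  let Y : Set X := π ⁻¹' S
  have hYinv : ∀ g, ∀ x ∈ Y, ρ g x ∈ Y := by
    intro g x hx
    change π (ρ g x) ∈ S
    rw [hπ]; exact hx
  have hYc : Yᶜ.ncard ≤ Nat.card F * (C * Fintype.card (Subgroup A)) * E.ncard := by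
    have h1 : Yᶜ.ncard ≤ Nat.card F * Sᶜ.card := by
      rw [Set.ncard_eq_toFinset_card']
      refine Finset.card_le_mul_card_image_of_maps_to (f := π) (fun x hx => ?_) _ fun ω _ => ?_
      · simpa [Y] using hx
      · rw [← Set.ncard_coe_finset]
        refine le_trans (Set.ncard_le_ncard (fun x hx => ?_) (Set.toFinite _)) (hfib ω)
        exact (Finset.mem_filter.mp hx).2
    have h2 : (Sᶜ.card : ℤ) ≤ C * (Fintype.card (Subgroup A) * E.ncard) := by
      refine hSc.trans (mul_le_mul_of_nonneg_left ?_ (by positivity))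
      refine (Finset.sum_le_sum fun K _ => htot K).trans ?_
      simp
    have h3 : Sᶜ.card ≤ C * (Fintype.card (Subgroup A) * E.ncard) := by exact_mod_cast h2
    calc _ ≤ _ := h1
      _ ≤ _ := Nat.mul_le_mul_left _ h3
      _ = _ := by ring
  obtain ⟨ρ', hρ'1, hρ'2⟩ := exists_hom_eq_on Y (fun g => ρ g) hYinv (by simp) (by simp)
  let U₀ : Set X := {x | x ∈ Y ∧ x ∉ E ∧ T x ∈ Y}
  obtain ⟨e, he1, he2, he3⟩ := exists_equivariant_bijOn α β (U := Y) (V := Y)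
    (fun a => hYinv (i a)) (fun a => hYinv (j a))
    (fun K => by have := hw S K; rw [hS0] at this; simp only [Y]; omega) U₀ (fun x hx => hx.1)
    (by
      rintro a x ⟨h1, h2, h3⟩
      refine ⟨hYinv _ _ h1, hEinv a x h2, ?_⟩
      have := hEc x h2 a
      simp only [α, MonoidHom.comp_apply]
      rw [this]
      exact hYinv _ _ h3) T (fun x hx => hx.2.2) T.injective.injOn (fun a x hx => hEc x hx.2.1 a)
  let τ : X → X := fun x => if x ∈ Y then e x else x
  have hτ1 : ∀ x ∈ Y, τ x = e x := fun x hx => if_pos hx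
  have hτ2 : ∀ x ∉ Y, τ x = x := fun x hx => if_neg hx
  have hτinj : Function.Injective τ := by
    intro x y hxy
    by_cases hx : x ∈ Y <;> by_cases hy : y ∈ Y
    · rw [hτ1 x hx, hτ1 y hy] at hxy; exact he2.injOn hx hy hxy
    · rw [hτ1 x hx, hτ2 y hy] at hxy; exact absurd (hxy ▸ he2.mapsTo hx) hy
    · rw [hτ2 x hx, hτ1 y hy] at hxy; exact absurd (hxy ▸ he2.mapsTo hy) hx
    · rwa [hτ2 x hx, hτ2 y hy] at hxy
  refine ⟨ρ', Equiv.ofBijective τ (Finite.injective_iff_bijective.mp hτinj),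
    Yᶜ ∪ E ∪ T ⁻¹' Yᶜ, fun a x => ?_, ?_, fun x hx => ?_⟩
  · simp only [Equiv.ofBijective_apply]
    by_cases hx : x ∈ Y
    · rw [hτ1 x hx, hρ'1 _ _ hx, hτ1 _ (hYinv _ _ hx), hρ'1 _ _ (he2.mapsTo hx)]
      exact he3 a x hx
    · rw [hτ2 x hx, hρ'2 _ _ hx, hρ'2 _ _ hx, hτ2 x hx]
  · have h1 : (T ⁻¹' Yᶜ).ncard = Yᶜ.ncard := by
      rw [← Equiv.image_symm_eq_preimage, Set.ncard_image_of_injective _ T.symm.injective]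
    have h2 := Set.ncard_union_le (Yᶜ ∪ E) (T ⁻¹' Yᶜ)
    have h3 := Set.ncard_union_le Yᶜ E
    calc _ ≤ 2 * Yᶜ.ncard + E.ncard := by omega
      _ ≤ 2 * (Nat.card F * (C * Fintype.card (Subgroup A)) * E.ncard) + E.ncard := by omega
      _ = _ := by ring
  · have hxY : x ∈ Y := by
      by_contra h
      exact hx (Or.inl (Or.inl h))
    have hxE : x ∉ E := fun h => hx (Or.inl (Or.inr h))
    have hTY : T x ∈ Y := by
      by_contra h
      exact hx (Or.inr h)
    exact ⟨(hτ1 x hxY).trans (he1 ⟨hxY, hxE, hTY⟩), fun g => hρ'1 g x hxY⟩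

end PermutationActions

section Hamming

variable {k : ℕ}

theorem dHam_eq_ncard (σ τ : Equiv.Perm (Fin k)) :
    dHam σ τ = ({x | σ x ≠ τ x}.ncard : ℝ) / k := by
  rw [dHam, Set.ncard_eq_toFinset_card']
  congr 3
  ext x
  simp

theorem dHam_nonneg (σ τ : Equiv.Perm (Fin k)) : 0 ≤ dHam σ τ := by
  rw [dHam]; positivity

theorem dHam_self (σ : Equiv.Perm (Fin k)) : dHam σ σ = 0 := by
  simp [dHam]

theorem dHam_comm (σ τ : Equiv.Perm (Fin k)) : dHam σ τ = dHam τ σ := by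
  simp only [dHam_eq_ncard, ne_comm]

theorem dHam_le_of_eqOn_compl {σ τ : Equiv.Perm (Fin k)} (Z : Set (Fin k))
    (h : ∀ x ∉ Z, σ x = τ x) : dHam σ τ ≤ (Z.ncard : ℝ) / k := by
  rw [dHam_eq_ncard]
  have : {x | σ x ≠ τ x}.ncard ≤ Z.ncard :=
    Set.ncard_le_ncard (fun x hx => by_contra fun hxZ => hx (h x hxZ)) (Set.toFinite _)
  gcongr

theorem dHam_triangle (σ τ υ : Equiv.Perm (Fin k)) : dHam σ υ ≤ dHam σ τ + dHam τ υ := by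
  refine (dHam_le_of_eqOn_compl ({x | σ x ≠ τ x} ∪ {x | τ x ≠ υ x}) fun x hx => ?_).trans ?_
  · simp only [Set.mem_union, Set.mem_ofPred_eq, not_or, not_not] at hx
    exact hx.1.trans hx.2
  · rw [dHam_eq_ncard, dHam_eq_ncard, ← add_div]
    gcongr
    exact_mod_cast Set.ncard_union_le _ _

theorem dHam_mul_left (π σ τ : Equiv.Perm (Fin k)) : dHam (π * σ) (π * τ) = dHam σ τ := by
  simp [dHam_eq_ncard]

theorem dHam_mul_right (π σ τ : Equiv.Perm (Fin k)) : dHam (σ * π) (τ * π) = dHam σ τ := by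
  rw [dHam_eq_ncard, dHam_eq_ncard]
  have : {x | (σ * π) x ≠ (τ * π) x} = π ⁻¹' {x | σ x ≠ τ x} := rfl
  rw [this, ← Equiv.image_symm_eq_preimage, Set.ncard_image_of_injective _ π.symm.injective]

theorem dHam_mul_le (σ σ' τ τ' : Equiv.Perm (Fin k)) :
    dHam (σ * σ') (τ * τ') ≤ dHam σ τ + dHam σ' τ' := by
  refine (dHam_triangle _ (τ * σ') _).trans ?_
  rw [dHam_mul_right, dHam_mul_left]

end Hamming

section AlmostHomomorphisms

variable {Γ : Type} [Group Γ] {k : ℕ → ℕ} {φ ψ : ∀ n, Γ → Equiv.Perm (Fin (k n))}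

theorem IsPartialHom.isAlmostHom (h : IsPartialHom k φ) : IsAlmostHom k φ := fun a b =>
  tendsto_const_nhds.congr' ((h a b).mono fun n hn => by simp only [hn, dHam_self])

theorem IsAlmostHom.tendsto_map_one (h : IsAlmostHom k φ) :
    Tendsto (fun n => dHam (φ n 1) 1) atTop (𝓝 0) := by
  refine (h 1 1).congr fun n => ?_
  have := dHam_mul_left (φ n 1) (φ n 1) 1
  rw [mul_one] at this
  rw [mul_one, this]

/-- The subgroup of elements at which two almost-homomorphisms are asymptotically close. -/
def closeSubgroup (hφ : IsAlmostHom k φ) (hψ : IsAlmostHom k ψ) : Subgroup Γ where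
  carrier := {g | Tendsto (fun n => dHam (φ n g) (ψ n g)) atTop (𝓝 0)}
  one_mem' := by
    refine squeeze_zero (fun n => dHam_nonneg _ _) (fun n => dHam_triangle _ 1 _)
      (g := fun n => dHam (φ n 1) 1 + dHam 1 (ψ n 1)) ?_
    simpa [dHam_comm] using hφ.tendsto_map_one.add hψ.tendsto_map_one
  mul_mem' := by
    intro a b ha hb
    refine squeeze_zero (fun n => dHam_nonneg _ _) (g := fun n =>
      dHam (φ n a * φ n b) (φ n (a * b)) + (dHam (φ n a) (ψ n a) + dHam (φ n b) (ψ n b))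
        + dHam (ψ n a * ψ n b) (ψ n (a * b))) (fun n => ?_) ?_
    · have h1 := dHam_triangle (φ n (a * b)) (φ n a * φ n b) (ψ n (a * b))
      have h2 := dHam_triangle (φ n a * φ n b) (ψ n a * ψ n b) (ψ n (a * b))
      have h3 := dHam_mul_le (φ n a) (φ n b) (ψ n a) (ψ n b)
      rw [dHam_comm (φ n (a * b)) (φ n a * φ n b)] at h1
      linarith
    · simpa using ((hφ a b).add (Tendsto.add ha hb)).add (hψ a b)
  inv_mem' := by
    intro a ha
    refine squeeze_zero (fun n => dHam_nonneg _ _) (g := fun n =>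
      dHam (φ n a * φ n a⁻¹) (φ n (a * a⁻¹)) + dHam (φ n 1) 1 + dHam (ψ n 1) 1 +
        dHam (ψ n a * ψ n a⁻¹) (ψ n (a * a⁻¹)) + dHam (φ n a) (ψ n a)) (fun n => ?_) ?_
    · have h0 := dHam_mul_left (φ n a) (φ n a⁻¹) (ψ n a⁻¹)
      have h1 := dHam_triangle (φ n a * φ n a⁻¹) (φ n 1) (φ n a * ψ n a⁻¹)
      have h2 := dHam_triangle (φ n 1) 1 (φ n a * ψ n a⁻¹)
      have h3 := dHam_triangle 1 (ψ n 1) (φ n a * ψ n a⁻¹)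
      have h4 := dHam_triangle (ψ n 1) (ψ n a * ψ n a⁻¹) (φ n a * ψ n a⁻¹)
      rw [dHam_mul_right, dHam_comm (ψ n a) (φ n a), dHam_comm (ψ n 1) (ψ n a * ψ n a⁻¹)] at h4
      rw [dHam_comm 1 (ψ n 1)] at h3
      simp only [mul_inv_cancel]
      linarith
    · simpa using ((((hφ a a⁻¹).add hφ.tendsto_map_one).add hψ.tendsto_map_one).add
        (hψ a a⁻¹)).add (show Tendsto _ _ _ from ha)

theorem mem_closeSubgroup {hφ : IsAlmostHom k φ} {hψ : IsAlmostHom k ψ} {g : Γ} :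
    g ∈ closeSubgroup hφ hψ ↔ Tendsto (fun n => dHam (φ n g) (ψ n g)) atTop (𝓝 0) := Iff.rfl

/-- On a finite set of group elements, an almost-homomorphism is multiplicative off a set of
vanishing density. -/
theorem IsAlmostHom.tendsto_ncard_defect (h : IsAlmostHom k φ) (S : Finset Γ) :
    Tendsto (fun n => ({x | ∃ a ∈ S, ∃ b ∈ S, φ n a (φ n b x) ≠ φ n (a * b) x}.ncard : ℝ) / k n)
      atTop (𝓝 0) := by
  refine squeeze_zero (fun n => by positivity) (g := fun n => ∑ p ∈ S ×ˢ S,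
    dHam (φ n p.1 * φ n p.2) (φ n (p.1 * p.2))) (fun n => ?_) ?_
  · simp only [dHam_eq_ncard]
    rw [← Finset.sum_div]
    gcongr
    have hsub : {x | ∃ a ∈ S, ∃ b ∈ S, φ n a (φ n b x) ≠ φ n (a * b) x} ⊆
        ⋃ p ∈ S ×ˢ S, {x | (φ n p.1 * φ n p.2) x ≠ φ n (p.1 * p.2) x} := by
      rintro x ⟨a, ha, b, hb, hx⟩
      simp only [Set.mem_iUnion]
      exact ⟨(a, b), Finset.mem_product.mpr ⟨ha, hb⟩, hx⟩
    have h1 := Set.ncard_le_ncard hsub (Set.toFinite _)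
    have h2 := Finset.set_ncard_biUnion_le (S ×ˢ S)
      fun p => {x | (φ n p.1 * φ n p.2) x ≠ φ n (p.1 * p.2) x}
    exact_mod_cast h1.trans h2
  · simpa using tendsto_finsetSum (S ×ˢ S) fun p _ => h p.1 p.2

/-- Near an almost-homomorphism there are genuine actions of a given finite subgroup `F` together
with a permutation `T` satisfying all conjugation relations of `t` between elements of `F`. -/
theorem IsAlmostHom.eventually_exists_exact (h : IsAlmostHom k φ) (F : Subgroup Γ) [Finite F]
    (t : Γ) {ε : ℝ} (hε : 0 < ε) :
    ∀ᶠ n in atTop, ∃ (ρ : F →* Equiv.Perm (Fin (k n))) (T : Equiv.Perm (Fin (k n))),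
      (∀ a b : F, t * a = b * t → T * ρ a = ρ b * T) ∧ dHam (φ n t) T ≤ ε ∧
        ∀ g : F, dHam (φ n g) (ρ g) ≤ ε := by
  have : Fintype F := Fintype.ofFinite F
  let A : Subgroup F := (F.comap (MulAut.conj t).toMonoidHom).subgroupOf F
  let i : A →* F := A.subtype
  let j : A →* F :=
    { toFun := fun a => ⟨t * a * t⁻¹, a.2⟩
      map_one' := by ext; simp
      map_mul' := by intro a b; ext; simp }
  obtain ⟨C, hC⟩ := exists_exact_intertwiner A F i j
  let S : Finset Γ := insert t (Finset.univ.image (Subtype.val : F → Γ))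
  have hFS : ∀ g : F, (g : Γ) ∈ S := fun g => by simp [S]
  have htS : t ∈ S := by simp [S]
  have hsmall := (h.tendsto_ncard_defect S).const_mul (2 * C + 1 : ℝ)
  rw [mul_zero] at hsmall
  filter_upwards [hsmall.eventually_le_const hε] with n hn
  set B := {x | ∃ a ∈ S, ∃ b ∈ S, φ n a (φ n b x) ≠ φ n (a * b) x} with hB
  have hBc : ∀ x ∉ B, ∀ a ∈ S, ∀ b ∈ S, φ n a (φ n b x) = φ n (a * b) x := by
    intro x hx a ha b hb
    by_contra hab
    exact hx ⟨a, ha, b, hb, hab⟩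
  let Y : Set (Fin (k n)) := {x | ∀ a b : F, φ n a (φ n b x) = φ n (a * b : F) x}
  have hBY : ∀ x ∉ B, x ∈ Y := fun x hx a b => hBc x hx a (hFS a) b (hFS b)
  obtain ⟨ρ, hρ, -⟩ := exists_hom_eq_on Y (fun g : F => φ n g)
    (by
      intro g x hx a b
      rw [hx b g, hx a (b * g), hx (a * b) g, mul_assoc])
    (by
      intro x hx
      have := hx 1 1
      rw [mul_one] at this
      exact (φ n (1 : F)).injective this)
    (fun a b x hx => (hx a b).symm)
  obtain ⟨ρ', T, Z, h1, h2, h3⟩ := hC (Fin (k n)) ρ (φ n t)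
  have hE : {x | ∃ a, φ n t (ρ (i a) x) ≠ ρ (j a) (φ n t x)}.ncard ≤ 2 * B.ncard := by
    have hsub : {x | ∃ a, φ n t (ρ (i a) x) ≠ ρ (j a) (φ n t x)} ⊆ B ∪ φ n t ⁻¹' B := by
      rintro x ⟨a, ha⟩
      by_contra hx
      simp only [Set.mem_union, Set.mem_preimage, not_or] at hx
      apply ha
      rw [hρ _ _ (hBY _ hx.1), hρ _ _ (hBY _ hx.2), hBc x hx.1 t htS _ (hFS _),
        hBc x hx.1 _ (hFS _) t htS]
      congr 2
      simp [i, j]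
    have h4 := Set.ncard_le_ncard hsub (Set.toFinite _)
    have h5 := Set.ncard_union_le B (φ n t ⁻¹' B)
    have h6 : (φ n t ⁻¹' B).ncard = B.ncard := by
      rw [← Equiv.image_symm_eq_preimage, Set.ncard_image_of_injective _ (φ n t).symm.injective]
    omega
  have hZB : ((Z ∪ B).ncard : ℝ) / k n ≤ ε := by
    refine le_trans ?_ hn
    rw [← mul_div_assoc]
    gcongr
    have h4 := Set.ncard_union_le Z B
    have h5 : Z.ncard ≤ C * (2 * B.ncard) := h2.trans (Nat.mul_le_mul_left _ hE)
    have h6 : (Z ∪ B).ncard ≤ (2 * C + 1) * B.ncard := by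
      calc _ ≤ C * (2 * B.ncard) + B.ncard := by omega
        _ = _ := by ring
    exact_mod_cast h6
  refine ⟨ρ', T, fun a b hab => ?_, ?_, fun g => ?_⟩
  · have hmem : t * a * t⁻¹ = b := by rw [hab]; simp
    have haA : a ∈ A := by
      change t * a * t⁻¹ ∈ F
      rw [hmem]; exact b.2
    ext x
    have h7 := h1 ⟨a, haA⟩ x
    have h8 : j ⟨a, haA⟩ = b := Subtype.ext hmem
    rw [h8] at h7
    exact congrArg Fin.val h7
  · refine (dHam_le_of_eqOn_compl (Z ∪ B) fun x hx => ?_).trans hZB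
    exact ((h3 x fun hZ => hx (Or.inl hZ)).1).symm
  · refine (dHam_le_of_eqOn_compl (Z ∪ B) fun x hx => ?_).trans hZB
    rw [(h3 x fun hZ => hx (Or.inl hZ)).2 g, hρ g x (hBY x fun hx' => hx (Or.inr hx'))]

end AlmostHomomorphisms

section LocallyFiniteByCyclic

theorem exists_tendsto_diagonal (P : ℕ → ℕ → Prop) (hP : ∀ m, ∀ᶠ n in atTop, P m n) :
    ∃ m : ℕ → ℕ, Tendsto m atTop atTop ∧ ∀ᶠ n in atTop, P (m n) n := by
  choose N hN using fun m => eventually_atTop.mp (hP m)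
  refine ⟨fun n => Nat.findGreatest (fun m => N m ≤ n) n, ?_, ?_⟩
  · refine tendsto_atTop.mpr fun M => ?_
    filter_upwards [eventually_ge_atTop (max M (N M))] with n hn
    exact Nat.le_findGreatest ((le_max_left _ _).trans hn) ((le_max_right _ _).trans hn)
  · filter_upwards [eventually_ge_atTop (N 0)] with n hn
    exact hN _ n (Nat.findGreatest_spec (P := fun m => N m ≤ n) (Nat.zero_le n) hn)

/-- A semidirect product of a countable locally finite group by `ℤ` is locally stable. -/
theorem isLocallyStable_semidirectProduct {L : Type} [Group L]
    (α : Multiplicative ℤ →* MulAut L) (F : ℕ → Subgroup L) (hmono : Monotone F)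
    (hfin : ∀ m, Finite (F m)) (hF : ∀ x, ∃ m, x ∈ F m) :
    IsLocallyStable (L ⋊[α] Multiplicative ℤ) := by
  intro k _ φ hφ
  let inl : L →* L ⋊[α] Multiplicative ℤ := SemidirectProduct.inl
  let t : L ⋊[α] Multiplicative ℤ := SemidirectProduct.inr (Multiplicative.ofAdd 1)
  let τ : MulAut L := α (Multiplicative.ofAdd 1)
  have hτ : ∀ x, t * inl x = inl (τ x) * t := by
    intro x
    have := SemidirectProduct.inl_aut (φ := α) (Multiplicative.ofAdd 1) x
    simp only [t, inl, τ, this]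
    simp
  let R : ∀ m n, (L → Equiv.Perm (Fin (k n))) → Equiv.Perm (Fin (k n)) → Prop := fun m n ρ T =>
    (∀ a ∈ F m, ∀ b ∈ F m, ρ (a * b) = ρ a * ρ b) ∧
    (∀ a ∈ F m, τ a ∈ F m → T * ρ a = ρ (τ a) * T) ∧
    dHam (φ n t) T ≤ 1 / ((m : ℝ) + 1) ∧ ∀ a ∈ F m, dHam (φ n (inl a)) (ρ a) ≤ 1 / ((m : ℝ) + 1)
  have hR : ∀ m, ∀ᶠ n in atTop, ∃ ρ T, R m n ρ T := by
    intro m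
    have := hfin m
    have : Finite ((F m).map inl) := by
      rw [← SetLike.coe_sort_coe, Subgroup.coe_map]
      exact Set.Finite.image _ (Set.toFinite _)
    filter_upwards [hφ.eventually_exists_exact ((F m).map inl) t
      (ε := 1 / ((m : ℝ) + 1)) (by positivity)] with n hn
    obtain ⟨ρ, T, h1, h2, h3⟩ := hn
    have hmem : ∀ {a}, a ∈ F m → inl a ∈ (F m).map inl := fun ha => Subgroup.mem_map_of_mem _ ha
    refine ⟨fun a => if ha : a ∈ F m then ρ ⟨inl a, hmem ha⟩ else 1, T, ?_, ?_, h2, ?_⟩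
    · intro a ha b hb
      simp only [dif_pos ha, dif_pos hb, dif_pos (mul_mem ha hb)]
      rw [← map_mul]
      congr 1
      exact Subtype.ext (map_mul inl a b)
    · intro a ha hta
      simp only [dif_pos ha, dif_pos hta]
      exact h1 _ _ (hτ a)
    · intro a ha
      simp only [dif_pos ha]
      exact h3 ⟨inl a, hmem ha⟩
  obtain ⟨m, hm, hmR⟩ := exists_tendsto_diagonal (fun m n => ∃ ρ T, R m n ρ T) hR
  have hex : ∀ n, ∃ ρ T, (∃ ρ' T', R (m n) n ρ' T') → R (m n) n ρ T := by
    intro n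
    by_cases h : ∃ ρ' T', R (m n) n ρ' T'
    · obtain ⟨ρ, T, h'⟩ := h
      exact ⟨ρ, T, fun _ => h'⟩
    · exact ⟨fun _ => 1, 1, fun h' => absurd h' h⟩
  choose ρ T hρT using hex
  have hev : ∀ᶠ n in atTop, R (m n) n (ρ n) (T n) := hmR.mono hρT
  have hmem : ∀ x, ∀ᶠ n in atTop, x ∈ F (m n) := by
    intro x
    obtain ⟨M, hM⟩ := hF x
    exact (hm.eventually_ge_atTop M).mono fun n hn => hmono hn hM
  have hmul : ∀ a b, ∀ᶠ n in atTop, ρ n (a * b) = ρ n a * ρ n b := by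
    intro a b
    filter_upwards [hev, hmem a, hmem b] with n h ha hb
    exact h.1 a ha b hb
  have hconj : ∀ a, ∀ᶠ n in atTop, T n * ρ n a = ρ n (τ a) * T n := by
    intro a
    filter_upwards [hev, hmem a, hmem (τ a)] with n h ha hb
    exact h.2.1 a ha hb
  have hzpow : ∀ (z : ℤ) a, ∀ᶠ n in atTop,
      T n ^ z * ρ n a = ρ n (α (Multiplicative.ofAdd z) a) * T n ^ z := by
    intro z
    induction z using Int.induction_on with
    | zero => intro a; simp
    | succ z ih =>
      intro a
      filter_upwards [ih a, hconj (α (Multiplicative.ofAdd (z : ℤ)) a)] with n h1 h2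
      rw [add_comm, zpow_one_add, mul_assoc, h1, ← mul_assoc, h2, mul_assoc, ofAdd_add, map_mul]
      rfl
    | pred z ih =>
      intro a
      filter_upwards [ih a, hconj (α (Multiplicative.ofAdd (-(z : ℤ) - 1)) a)] with n h1 h2
      have h3 : τ (α (Multiplicative.ofAdd (-(z : ℤ) - 1)) a) =
          α (Multiplicative.ofAdd (-(z : ℤ))) a := by
        rw [← MulAut.mul_apply, ← map_mul, ← ofAdd_add]
        congr 3
        ring
      rw [h3] at h2
      have h4 : T n ^ (-(z : ℤ) - 1) = (T n)⁻¹ * T n ^ (-(z : ℤ)) := by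
        rw [sub_eq_neg_add, zpow_add, zpow_neg_one]
      rw [h4, mul_assoc, h1, ← mul_assoc, ← mul_assoc]
      congr 1
      rw [inv_mul_eq_iff_eq_mul, ← mul_assoc, h2, mul_inv_cancel_right]
  let ψ : ∀ n, L ⋊[α] Multiplicative ℤ → Equiv.Perm (Fin (k n)) := fun n g =>
    ρ n g.left * T n ^ (Multiplicative.toAdd g.right)
  have hψ : IsPartialHom k ψ := by
    intro g h
    filter_upwards [hmul g.left (α g.right h.left), hzpow (Multiplicative.toAdd g.right) h.left]
      with n h1 h2
    simp only [ψ, SemidirectProduct.mul_left, SemidirectProduct.mul_right, toAdd_mul, zpow_add, h1]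
    rw [ofAdd_toAdd] at h2
    rw [mul_assoc, ← mul_assoc _ (T n ^ _), ← h2]
    simp only [mul_assoc]
  have hlim : Tendsto (fun n => 1 / ((m n : ℝ) + 1)) atTop (𝓝 0) :=
    tendsto_one_div_add_atTop_nhds_zero_nat.comp hm
  refine ⟨ψ, hψ, fun g => ?_⟩
  rw [← mem_closeSubgroup (hφ := hφ) (hψ := hψ.isAlmostHom)]
  have hone : ∀ᶠ n in atTop, ρ n 1 = 1 := by
    filter_upwards [hmul 1 1] with n hn
    simpa using hn
  rw [← SemidirectProduct.inl_left_mul_inr_right g]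
  refine mul_mem ?_ ?_
  · rw [mem_closeSubgroup]
    refine squeeze_zero' (Eventually.of_forall fun n => dHam_nonneg _ _) ?_ hlim
    filter_upwards [hev, hmem g.left] with n h1 h2
    simpa [ψ] using h1.2.2.2 _ h2
  · have ht : t ∈ closeSubgroup hφ hψ.isAlmostHom := by
      rw [mem_closeSubgroup]
      refine squeeze_zero' (Eventually.of_forall fun n => dHam_nonneg _ _) ?_ hlim
      filter_upwards [hev, hone] with n h1 h2
      simpa [ψ, t, h2] using h1.2.2.1
    have h5 : SemidirectProduct.inr g.right = t ^ (Multiplicative.toAdd g.right) := by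
      rw [← map_zpow]
      congr 1
      rw [← ofAdd_zsmul]
      simp
    rw [h5]
    exact zpow_mem ht _

end LocallyFiniteByCyclic

section Heisenberg

/-- The bilinear form on finitely supported `ZMod 2`-valued functions whose matrix entry at `(i, j)`
is `f (i - j)`. -/
noncomputable def differenceForm {G : Type} [AddCommGroup G] (f : G → ZMod 2) :
    (G →₀ ZMod 2) →ₗ[ZMod 2] (G →₀ ZMod 2) →ₗ[ZMod 2] ZMod 2 :=
  Finsupp.linearCombination (ZMod 2) fun i =>
    Finsupp.linearCombination (ZMod 2) fun j => f (i - j)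

/-- The central extension of `G →₀ ZMod 2` by `ZMod 2` with cocycle `differenceForm f`. -/
@[ext]
structure Heis (G : Type) (f : G → ZMod 2) where
  vec : G →₀ ZMod 2
  cen : ZMod 2

variable {G : Type} [AddCommGroup G] {f : G → ZMod 2}

theorem differenceForm_single (i j : G) (a b : ZMod 2) :
    differenceForm f (Finsupp.single i a) (Finsupp.single j b) = a * b * f (i - j) := by
  simp [differenceForm, mul_assoc]

theorem differenceForm_mapDomain {H : Type} [AddCommGroup H] {f' : H → ZMod 2} (q : G → H)
    (u v : G →₀ ZMod 2)
    (h : ∀ i ∈ u.support, ∀ j ∈ v.support, f' (q i - q j) = f (i - j)) :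
    differenceForm f' (u.mapDomain q) (v.mapDomain q) = differenceForm f u v := by
  simp only [differenceForm, Finsupp.linearCombination_mapDomain]
  simp only [Finsupp.linearCombination_apply, Finsupp.sum, LinearMap.sum_apply,
    LinearMap.smul_apply]
  refine Finset.sum_congr rfl fun i hi => ?_
  simp only [Function.comp_apply, Finsupp.linearCombination_mapDomain]
  simp only [Finsupp.linearCombination_apply, Finsupp.sum]
  congr 1
  refine Finset.sum_congr rfl fun j hj => ?_
  rw [Function.comp_apply, h i hi j hj]

namespace Heis

noncomputable instance : Mul (Heis G f) :=
  ⟨fun x y => ⟨x.vec + y.vec, x.cen + y.cen + differenceForm f x.vec y.vec⟩⟩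

instance {G : Type} {f : G → ZMod 2} : One (Heis G f) := ⟨⟨0, 0⟩⟩

noncomputable instance : Inv (Heis G f) :=
  ⟨fun x => ⟨-x.vec, -x.cen + differenceForm f x.vec x.vec⟩⟩

@[simp] theorem vec_mul (x y : Heis G f) : (x * y).vec = x.vec + y.vec := rfl
@[simp] theorem cen_mul (x y : Heis G f) :
    (x * y).cen = x.cen + y.cen + differenceForm f x.vec y.vec := rfl
@[simp] theorem vec_one {G : Type} {f : G → ZMod 2} : (1 : Heis G f).vec = 0 := rfl
@[simp] theorem cen_one {G : Type} {f : G → ZMod 2} : (1 : Heis G f).cen = 0 := rfl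
@[simp] theorem vec_inv (x : Heis G f) : (x⁻¹).vec = -x.vec := rfl
@[simp] theorem cen_inv (x : Heis G f) :
    (x⁻¹).cen = -x.cen + differenceForm f x.vec x.vec := rfl

noncomputable instance : Group (Heis G f) :=
  Group.ofLeftAxioms
    (fun x y z => by
      ext1
      · simp [add_assoc]
      · simp only [cen_mul, vec_mul, map_add, LinearMap.add_apply]; ring)
    (fun x => by ext1 <;> simp)
    (fun x => by
      ext1
      · simp only [vec_mul, vec_inv, vec_one, neg_add_cancel]
      · simp only [cen_mul, cen_inv, vec_inv, map_neg, LinearMap.neg_apply, cen_one]; ring)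

instance [Finite G] : Finite (Heis G f) :=
  Finite.of_injective (fun x : Heis G f => ((x.vec : G → ZMod 2), x.cen)) fun x y h => by
    ext1
    · exact DFunLike.coe_injective (congrArg Prod.fst h)
    · exact congrArg Prod.snd h

instance [Countable G] : Countable (Heis G f) :=
  Function.Injective.countable (f := fun x : Heis G f => (x.vec, x.cen)) fun x y h => by
    ext1
    · exact congrArg Prod.fst h
    · exact congrArg Prod.snd h

/-- Translation of the index set. -/
noncomputable def shift (G : Type) [AddCommGroup G] (f : G → ZMod 2) :
    Multiplicative G →* MulAut (Heis G f) where
  toFun g :=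
    { toFun := fun x => ⟨x.vec.mapDomain (g.toAdd + ·), x.cen⟩
      invFun := fun x => ⟨x.vec.mapDomain (-g.toAdd + ·), x.cen⟩
      left_inv := fun x => by
        ext1
        · simp only [← Finsupp.mapDomain_comp]
          convert Finsupp.mapDomain_id
          ext; simp
        · rfl
      right_inv := fun x => by
        ext1
        · simp only [← Finsupp.mapDomain_comp]
          convert Finsupp.mapDomain_id
          ext; simp
        · rfl
      map_mul' := fun x y => by
        ext1
        · simp [Finsupp.mapDomain_add]
        · simp only [cen_mul]
          rw [differenceForm_mapDomain (f := f)]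
          intro i _ j _
          rw [add_sub_add_left_eq_sub] }
  map_one' := by
    ext1 x
    ext1
    · change x.vec.mapDomain _ = x.vec
      convert Finsupp.mapDomain_id
      simp
    · rfl
  map_mul' g h := by
    ext1 x
    ext1
    · change x.vec.mapDomain _ = (x.vec.mapDomain _).mapDomain _
      rw [← Finsupp.mapDomain_comp]
      congr 1
      funext i
      simp [add_assoc]
    · rfl

@[simp] theorem vec_shift (g : Multiplicative G) (x : Heis G f) :
    (shift G f g x).vec = x.vec.mapDomain (g.toAdd + ·) := rfl
@[simp] theorem cen_shift (g : Multiplicative G) (x : Heis G f) :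
    (shift G f g x).cen = x.cen := rfl

end Heis

/-- The elements whose first component is supported in a given set. -/
def Heis.supported (f : G → ZMod 2) (s : Set G) : Subgroup (Heis G f) where
  carrier := {x | x.vec ∈ Finsupp.supported (ZMod 2) (ZMod 2) s}
  one_mem' := (Finsupp.supported (ZMod 2) (ZMod 2) s).zero_mem
  mul_mem' hx hy := (Finsupp.supported (ZMod 2) (ZMod 2) s).add_mem hx hy
  inv_mem' hx := (Finsupp.supported (ZMod 2) (ZMod 2) s).neg_mem hx

/-- The extension of `Heis G f` by translations. -/
abbrev HeisShift (G : Type) [AddCommGroup G] (f : G → ZMod 2) : Type :=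
  Heis G f ⋊[Heis.shift G f] Multiplicative G

namespace HeisShift

/-- The basis vector at the origin. -/
noncomputable def gen (G : Type) [AddCommGroup G] (f : G → ZMod 2) : HeisShift G f :=
  SemidirectProduct.inl ⟨Finsupp.single 0 1, 0⟩

/-- The central element of order two. -/
noncomputable def central (G : Type) [AddCommGroup G] (f : G → ZMod 2) : HeisShift G f :=
  SemidirectProduct.inl ⟨0, 1⟩

/-- Translation by `g`. -/
noncomputable def translation (f : G → ZMod 2) (g : G) : HeisShift G f :=
  SemidirectProduct.inr (Multiplicative.ofAdd g)

theorem translation_conj (g : G) (x : Heis G f) :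
    translation f g * SemidirectProduct.inl x * (translation f g)⁻¹ =
      SemidirectProduct.inl (Heis.shift G f (Multiplicative.ofAdd g) x) := by
  rw [translation, SemidirectProduct.inl_aut, map_inv]

theorem translation_conj_gen (g : G) :
    translation f g * gen G f * (translation f g)⁻¹ =
      SemidirectProduct.inl ⟨Finsupp.single g 1, 0⟩ := by
  rw [gen, translation_conj]
  congr 1
  ext1 <;> simp [Finsupp.mapDomain_single]

theorem translation_zsmul (g : G) (n : ℤ) : translation f (n • g) = translation f g ^ n := by
  rw [translation, translation, ofAdd_zsmul, map_zpow]

theorem central_ne_one : central G f ≠ 1 := by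
  intro h
  have h1 := congrArg (fun x => x.left.cen) h
  simp [central] at h1

/-- Commuting a translate of the generator past the generator. -/
theorem conj_gen_mul_gen (g : G) :
    translation f g * gen G f * (translation f g)⁻¹ * gen G f =
      central G f ^ (f g - f (-g)).val *
        (gen G f * (translation f g * gen G f * (translation f g)⁻¹)) := by
  rw [translation_conj_gen, gen, central, ← map_pow, ← map_mul, ← map_mul, ← map_mul]
  congr 1
  have hpow : ∀ z : ZMod 2, (⟨0, 1⟩ : Heis G f) ^ z.val = ⟨0, z⟩ := by
    intro z
    fin_cases z
    · rfl
    · exact pow_one _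
  rw [hpow]
  ext1
  · simp [add_comm]
  · simp [differenceForm_single]

theorem fg_int (f : ℤ → ZMod 2) : Group.FG (HeisShift ℤ f) := by
  let K : Subgroup (HeisShift ℤ f) :=
    Subgroup.closure {gen ℤ f, central ℤ f, translation f 1}
  have hg : gen ℤ f ∈ K := Subgroup.subset_closure (by simp)
  have hc : central ℤ f ∈ K := Subgroup.subset_closure (by simp)
  have ht : ∀ n : ℤ, translation f n ∈ K := fun n => by
    have h1 : translation f 1 ∈ K := Subgroup.subset_closure (by simp)
    have := translation_zsmul (f := f) 1 n
    rw [smul_eq_mul, mul_one] at this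
    exact this ▸ K.zpow_mem h1 n
  have hcen : ∀ z : ZMod 2, (SemidirectProduct.inl ⟨0, z⟩ : HeisShift ℤ f) ∈ K := by
    intro z
    fin_cases z
    · exact K.one_mem
    · exact hc
  have hvec : ∀ u : ℤ →₀ ZMod 2, ∀ z, (SemidirectProduct.inl ⟨u, z⟩ : HeisShift ℤ f) ∈ K := by
    intro u
    induction u using Finsupp.induction_linear with
    | zero => exact hcen
    | add u v hu hv =>
      intro z
      have := K.mul_mem (hu 0) (hv (z - differenceForm f u v))
      rw [← map_mul] at this
      convert this using 2
      ext1 <;> simp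
    | single i a =>
      intro z
      fin_cases a
      · convert hcen z
        exact Finsupp.single_zero i
      · have h1 := K.mul_mem (K.mul_mem (ht i) hg) (K.inv_mem (ht i))
        rw [translation_conj_gen] at h1
        have := K.mul_mem h1 (hcen z)
        rw [← map_mul] at this
        convert this using 2
        ext1 <;> simp
        rfl
  refine ⟨⟨{gen ℤ f, central ℤ f, translation f 1}, ?_⟩⟩
  rw [eq_top_iff]
  intro x _
  have := K.mul_mem (hvec x.left.vec x.left.cen) (ht x.right.toAdd)
  rw [← SemidirectProduct.inl_left_mul_inr_right x]
  rwa [Finset.coe_insert, Finset.coe_insert, Finset.coe_singleton]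

theorem isLocallyStable_int (f : ℤ → ZMod 2) : IsLocallyStable (HeisShift ℤ f) := by
  refine isLocallyStable_semidirectProduct _
    (fun m : ℕ => Heis.supported f (Set.Icc (-m : ℤ) m)) ?_ ?_ ?_
  · intro m m' h x hx
    refine Finsupp.supported_mono (M := ZMod 2) (R := ZMod 2) (Set.Icc_subset_Icc ?_ ?_) hx <;> simp [h]
  · intro m
    have : Finite (Finsupp.supported (ZMod 2) (ZMod 2) (Set.Icc (-m : ℤ) m)) :=
      Finite.of_equiv _ (Finsupp.supportedEquivFinsupp _).toEquiv.symm
    refine Finite.of_injective (β := Finsupp.supported (ZMod 2) (ZMod 2) (Set.Icc (-m : ℤ) m) ×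
      ZMod 2) (fun x => (⟨x.1.vec, x.2⟩, x.1.cen)) fun x y h => ?_
    have h1 := congrArg Prod.fst h
    have h2 := congrArg Prod.snd h
    exact Subtype.ext (Heis.ext (congrArg Subtype.val h1) h2)
  · intro x
    refine ⟨x.vec.support.sup Int.natAbs, fun i hi => ?_⟩
    have := Finset.le_sup (f := Int.natAbs) (Finset.mem_coe.mp hi)
    simp only [Set.mem_Icc]
    omega

end HeisShift

end Heisenberg

section Quotients

open HeisShift

/-- A function on the integers, transported to `ZMod N` by balanced representatives. -/
def balancedFun (f : ℤ → ZMod 2) (N : ℕ) (x : ZMod N) : ZMod 2 := f x.valMinAbs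

theorem eventually_valMinAbs_intCast (z : ℤ) :
    ∀ᶠ n : ℕ in atTop, ((z : ZMod (n + 1)).valMinAbs : ℤ) = z := by
  filter_upwards [eventually_ge_atTop (2 * z.natAbs)] with n hn
  refine (ZMod.valMinAbs_spec _ _).mpr ⟨rfl, ?_⟩
  rw [Set.mem_Ioc]
  push_cast
  omega

/-- Reduction of the index set and of translations modulo `n + 1`. -/
noncomputable def reduceMod (f : ℤ → ZMod 2) (n : ℕ) (x : HeisShift ℤ f) :
    HeisShift (ZMod (n + 1)) (balancedFun f (n + 1)) :=
  ⟨⟨x.left.vec.mapDomain (Int.cast : ℤ → ZMod (n + 1)), x.left.cen⟩,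
    Multiplicative.ofAdd (x.right.toAdd : ZMod (n + 1))⟩

theorem eventually_reduceMod_mul (f : ℤ → ZMod 2) (x y : HeisShift ℤ f) :
    ∀ᶠ n in atTop, reduceMod f n (x * y) = reduceMod f n x * reduceMod f n y := by
  have h : ∀ᶠ n : ℕ in atTop, ∀ i ∈ x.left.vec.support,
      ∀ j ∈ (Heis.shift ℤ f x.right y.left).vec.support,
        ((i - j : ℤ) : ZMod (n + 1)).valMinAbs = i - j :=
    (Finset.eventually_all _).mpr fun i _ => (Finset.eventually_all _).mpr fun j _ =>
      eventually_valMinAbs_intCast (i - j)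
  filter_upwards [h] with n hn
  have hvec : (Heis.shift ℤ f x.right y.left).vec.mapDomain (Int.cast : ℤ → ZMod (n + 1)) =
      (Heis.shift _ (balancedFun f (n + 1)) (reduceMod f n x).right (reduceMod f n y).left).vec := by
    simp only [Heis.vec_shift, reduceMod, ← Finsupp.mapDomain_comp]
    congr 1
    funext i
    simp
  refine SemidirectProduct.ext (Heis.ext ?_ ?_) ?_
  · simp only [SemidirectProduct.mul_left, Heis.vec_mul, ← hvec]
    simp only [reduceMod, SemidirectProduct.mul_left, Heis.vec_mul, Finsupp.mapDomain_add]
  · simp only [SemidirectProduct.mul_left, Heis.cen_mul, ← hvec]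
    simp only [reduceMod, SemidirectProduct.mul_left, Heis.cen_mul]
    rw [differenceForm_mapDomain (f := f)]
    · rfl
    · intro i hi j hj
      rw [balancedFun, ← Int.cast_sub, hn i hi j hj]
  · simp [reduceMod]

theorem eventually_reduceMod_ne_one (f : ℤ → ZMod 2) {x : HeisShift ℤ f} (hx : x ≠ 1) :
    ∀ᶠ n in atTop, reduceMod f n x ≠ 1 := by
  have h : ∀ᶠ n : ℕ in atTop, ∀ i ∈ x.left.vec.support,
      ((i : ℤ) : ZMod (n + 1)).valMinAbs = i :=
    (Finset.eventually_all _).mpr fun i _ => eventually_valMinAbs_intCast i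
  filter_upwards [h, eventually_valMinAbs_intCast x.right.toAdd] with n hn hr h1
  refine hx (SemidirectProduct.ext (Heis.ext ?_ ?_) ?_)
  · have h2 : x.left.vec.mapDomain (Int.cast : ℤ → ZMod (n + 1)) = 0 :=
      congrArg (fun y => y.left.vec) h1
    have h3 := congrArg (Finsupp.mapDomain (ZMod.valMinAbs (n := n + 1))) h2
    rw [← Finsupp.mapDomain_comp, Finsupp.mapDomain_zero] at h3
    rw [← Finsupp.mapDomain_id (v := x.left.vec)]
    exact (Finsupp.mapDomain_congr fun i hi => (hn i hi).symm).trans h3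
  · exact congrArg (fun y => y.left.cen) h1
  · have h2 : ((x.right.toAdd : ℤ) : ZMod (n + 1)) = 0 := congrArg (fun y => y.right.toAdd) h1
    rw [h2, ZMod.valMinAbs_zero] at hr
    exact hr.symm

instance {G : Type} [AddCommGroup G] [Finite G] (f : G → ZMod 2) : Finite (HeisShift G f) :=
  Finite.of_equiv _ SemidirectProduct.equivProd.symm

instance {G : Type} [AddCommGroup G] [Countable G] (f : G → ZMod 2) :
    Countable (HeisShift G f) :=
  have : Countable (Multiplicative G) := ‹Countable G›
  Countable.of_equiv _ SemidirectProduct.equivProd.symm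

/-- The left regular representation of a finite group, on an initial segment of the naturals. -/
noncomputable def regularRep (Q : Type) [Group Q] [Finite Q] :
    Q →* Equiv.Perm (Fin (Nat.card Q)) :=
  (Finite.equivFin Q).permCongrHom.toMonoidHom.comp (MulAction.toPermHom Q Q)

theorem dHam_regularRep_one {Q : Type} [Group Q] [Finite Q] {q : Q} (hq : q ≠ 1) :
    dHam (regularRep Q q) 1 = 1 := by
  have h : {x | regularRep Q q x ≠ (1 : Equiv.Perm (Fin (Nat.card Q))) x} = Set.univ := by
    refine Set.eq_univ_of_forall fun x hx => hq ?_
    have h1 := congrArg (Finite.equivFin Q).symm hx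
    simpa [regularRep, Equiv.permCongrHom] using h1
  rw [dHam_eq_ncard, h, Set.ncard_univ, Nat.card_eq_fintype_card, Fintype.card_fin]
  exact div_self (Nat.cast_ne_zero.mpr Nat.card_pos.ne')

/-- If `f` is asymmetric at every positive even integer, the central element dies in every finite
quotient. -/
theorem HeisShift.map_central_eq_one {f : ℤ → ZMod 2}
    (hf : ∀ n : ℕ, 0 < n → f (2 * n) = 1 ∧ f (-(2 * n)) = 0) {Q : Type} [Group Q] [Finite Q]
    (ψ : HeisShift ℤ f →* Q) : ψ (central ℤ f) = 1 := by
  obtain ⟨h1, h2⟩ := hf (Nat.card Q) Nat.card_pos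
  have h := conj_gen_mul_gen (f := f) (2 * (Nat.card Q : ℤ))
  have ht : ψ (translation f (2 * (Nat.card Q : ℤ))) = 1 := by
    have := translation_zsmul (f := f) 2 (Nat.card Q : ℤ)
    rw [smul_eq_mul, mul_comm] at this
    rw [this, map_zpow, zpow_natCast, pow_card_eq_one']
  rw [h1, h2, sub_zero, show (1 : ZMod 2).val = 1 from rfl, pow_one] at h
  have h3 := congrArg ψ h
  simpa [ht] using h3

theorem HeisShift.not_isWeaklyStable {f : ℤ → ZMod 2}
    (hf : ∀ n : ℕ, 0 < n → f (2 * n) = 1 ∧ f (-(2 * n)) = 0) :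
    ¬ IsWeaklyStable (HeisShift ℤ f) := by
  intro hw
  let Q : ℕ → Type := fun n => HeisShift (ZMod (n + 1)) (balancedFun f (n + 1))
  let φ : ∀ n, HeisShift ℤ f → Equiv.Perm (Fin (Nat.card (Q n))) :=
    fun n x => regularRep (Q n) (reduceMod f n x)
  have hφ : IsPartialHom (fun n => Nat.card (Q n)) φ := fun x y =>
    (eventually_reduceMod_mul f x y).mono fun n hn => by simp only [φ, hn, map_mul]
  have hsep : IsSeparating (fun n => Nat.card (Q n)) φ := fun x hx =>
    tendsto_const_nhds.congr' ((eventually_reduceMod_ne_one f hx).mono fun n hn =>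
      (dHam_regularRep_one hn).symm)
  obtain ⟨ψ, hψ, hclose⟩ := hw _ (fun n => Nat.card_pos) φ hφ.isAlmostHom hsep
  have hc : ∀ n, ψ n (central ℤ f) = 1 := fun n =>
    map_central_eq_one hf (MonoidHom.mk' (ψ n) (hψ n))
  have h0 := hclose (central ℤ f)
  simp only [hc] at h0
  exact zero_ne_one (tendsto_nhds_unique h0 (hsep _ central_ne_one))

end Quotients

section Family

open HeisShift

/-- The function on the integers that vanishes on nonpositive integers, is `1` on positive even
integers, and at odd positive integers `2 * s + 1` is the indicator of `s ∈ S`. -/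
noncomputable def codingFun (S : Set ℕ) (d : ℤ) : ZMod 2 :=
  if 0 < d ∧ (Even d ∨ d.toNat / 2 ∈ S) then 1 else 0

theorem codingFun_even (S : Set ℕ) (n : ℕ) (hn : 0 < n) :
    codingFun S (2 * n) = 1 ∧ codingFun S (-(2 * n)) = 0 := by
  constructor
  · rw [codingFun, if_pos ⟨by omega, Or.inl (even_two_mul _)⟩]
  · rw [codingFun, if_neg fun h => by omega]

theorem codingFun_odd (S : Set ℕ) (s : ℕ) :
    codingFun S (2 * s + 1) - codingFun S (-(2 * s + 1)) = if s ∈ S then 1 else 0 := by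
  have h1 : ¬ Even (2 * (s : ℤ) + 1) := Int.not_even_iff_odd.mpr ⟨s, rfl⟩
  have h2 : (2 * (s : ℤ) + 1).toNat / 2 = s := by omega
  rw [codingFun, codingFun, if_neg (c := 0 < -(2 * (s : ℤ) + 1) ∧ _) fun h => by omega, sub_zero]
  simp only [h1, h2, false_or, show 0 < 2 * (s : ℤ) + 1 by omega, true_and]

/-- The set `S` is read off from which odd translates of the generator fail to commute with it. -/
theorem HeisShift.mem_iff_not_commute (S : Set ℕ) (s : ℕ) :
    s ∈ S ↔ ¬ Commute (translation (codingFun S) 1 ^ (2 * s + 1) * gen ℤ (codingFun S) *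
      (translation (codingFun S) 1 ^ (2 * s + 1))⁻¹) (gen ℤ (codingFun S)) := by
  have ht : translation (codingFun S) 1 ^ (2 * s + 1) =
      translation (codingFun S) (2 * s + 1 : ℤ) := by
    have := translation_zsmul (f := codingFun S) 1 (2 * s + 1 : ℤ)
    rw [smul_eq_mul, mul_one] at this
    rw [this, ← zpow_natCast]
    norm_cast
  rw [ht, Commute, SemiconjBy, conj_gen_mul_gen, codingFun_odd, mul_eq_right]
  by_cases hs : s ∈ S
  · simp only [hs, if_true, true_iff]
    rw [show (1 : ZMod 2).val = 1 from rfl, pow_one]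
    exact central_ne_one
  · simp [hs]

theorem HeisShift.mem_iff_not_commute_map (S : Set ℕ) {K : Type} [Group K]
    (e : HeisShift ℤ (codingFun S) ≃* K) (s : ℕ) :
    s ∈ S ↔ ¬ Commute (e (translation (codingFun S) 1) ^ (2 * s + 1) * e (gen ℤ (codingFun S)) *
      (e (translation (codingFun S) 1) ^ (2 * s + 1))⁻¹) (e (gen ℤ (codingFun S))) := by
  rw [mem_iff_not_commute S s, ← map_pow, ← map_inv, ← map_mul, ← map_mul,
    commute_map_iff e.injective]

/-- Isomorphism of the groups coded by sets of naturals. -/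
def codingSetoid : Setoid (Set ℕ) where
  r S S' := Nonempty (HeisShift ℤ (codingFun S) ≃* HeisShift ℤ (codingFun S'))
  iseqv :=
    ⟨fun _ => ⟨MulEquiv.refl _⟩, fun ⟨e⟩ => ⟨e.symm⟩, fun ⟨e⟩ ⟨e'⟩ => ⟨e.trans e'⟩⟩

theorem mk_quotient_codingSetoid : Cardinal.mk (Quotient codingSetoid) = Cardinal.continuum := by
  have hset : Cardinal.mk (Set ℕ) = Cardinal.continuum := by simp
  refine le_antisymm (Cardinal.mk_quotient_le.trans hset.le) ?_
  let H : Quotient codingSetoid → Type := fun q => HeisShift ℤ (codingFun q.out)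
  have e : ∀ S : Set ℕ, Nonempty (HeisShift ℤ (codingFun S) ≃* H ⟦S⟧) := fun S =>
    codingSetoid.symm (Quotient.exact (Quotient.out_eq (⟦S⟧ : Quotient codingSetoid)))
  let e := fun S => (e S).some
  let code : Set ℕ → Σ q, H q × H q := fun S =>
    ⟨⟦S⟧, e S (translation _ 1), e S (gen _ _)⟩
  let decode : (Σ q, H q × H q) → Set ℕ := fun p =>
    {s | ¬ Commute (p.2.1 ^ (2 * s + 1) * p.2.2 * (p.2.1 ^ (2 * s + 1))⁻¹) p.2.2}
  have hcode : Function.LeftInverse decode code := fun S => by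
    ext s
    exact (mem_iff_not_commute_map S (e S) s).symm
  have h1 := Cardinal.mk_le_of_injective hcode.injective
  have h2 : Cardinal.mk (Σ q, H q × H q) ≤ Cardinal.mk (Quotient codingSetoid) * Cardinal.aleph0 := by
    rw [Cardinal.mk_sigma]
    refine (Cardinal.sum_le_sum _ (fun _ => Cardinal.aleph0) fun q => ?_).trans ?_
    · exact Cardinal.mk_le_aleph0
    · simp
  rw [hset] at h1
  by_contra! hlt
  have h3 := Cardinal.mul_lt_of_lt Cardinal.aleph0_le_continuum hlt Cardinal.aleph0_lt_continuum
  exact absurd (h1.trans h2) h3.not_ge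

end Family

/-- There is a continuum of pairwise nonisomorphic finitely generated groups which are
locally stable but not weakly stable. -/
theorem exists_continuum_locallyStable_not_weaklyStable :
    ∃ (I : Type) (G : I → Type) (_ : ∀ i, Group (G i)),
      Cardinal.mk I = Cardinal.continuum ∧
      (∀ i, Group.FG (G i)) ∧
      (∀ i, IsLocallyStable (G i)) ∧
      (∀ i, ¬ IsWeaklyStable (G i)) ∧
      (∀ i j, i ≠ j → IsEmpty (G i ≃* G j)) := by
  refine ⟨Quotient codingSetoid, fun q => HeisShift ℤ (codingFun q.out), fun _ => inferInstance,
    mk_quotient_codingSetoid, fun _ => HeisShift.fg_int _,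
    fun _ => HeisShift.isLocallyStable_int _,
    fun q => HeisShift.not_isWeaklyStable (codingFun_even q.out), fun p q hpq => ⟨fun e => hpq ?_⟩⟩
  rw [← p.out_eq, ← q.out_eq]
  exact Quotient.sound ⟨e⟩
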